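/- Let x_min > 0 and let h : [x_min, ∞) → ℝ_{>0} be monotonically increasing. Define g(x) = 0 for 0 ≤ x < x_min and g(x) = x_min/h(x_min) + ∫_{x_min}^{x} dz/h(z) for x ≥ x_min. Then for all x ≥ x_min and all y ≥ 0, g(x) − g(y) ≥ (x − y)/h(x). -/

import Mathlib

/-- **Potential-function inequality covering values below the target** `xmin`:
with `g x = 0` for `0 ≤ x < xmin` and
`g x = xmin / h xmin + ∫_{xmin}^{x} dz / h z` for `x ≥ xmin`, one has
`g x − g y ≥ (x − y) / h x` for all `x ≥ xmin` and all `y ≥ 0`. -/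
theorem variable_drift_potential_inequality_below_target
    (xmin : ℝ) (hxmin : 0 < xmin)
    (h : ℝ → ℝ)
    (hmono : MonotoneOn h (Set.Ici xmin))
    (hpos : ∀ x ∈ Set.Ici xmin, 0 < h x)
    (g : ℝ → ℝ)
    (hg_below : ∀ x, 0 ≤ x → x < xmin → g x = 0)
    (hg_above : ∀ x, xmin ≤ x → g x = xmin / h xmin + ∫ z in xmin..x, 1 / h z) :
    ∀ x, xmin ≤ x → ∀ y, 0 ≤ y → (x - y) / h x ≤ g x - g y := by
  have anti : AntitoneOn (fun z => 1 / h z) (Set.Ici xmin) := fun a ha b hb hab =>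
    one_div_le_one_div_of_le (hpos a ha) (hmono ha hb hab)
  have hint : ∀ a b, xmin ≤ a → xmin ≤ b →
      IntervalIntegrable (fun z => 1 / h z) MeasureTheory.volume a b := by
    intro a b ha hb
    apply AntitoneOn.intervalIntegrable
    apply anti.mono
    intro z hz
    exact (le_min ha hb).trans hz.1
  have lower : ∀ a b, xmin ≤ a → a ≤ b → (b - a) / h b ≤ ∫ z in a..b, 1 / h z := by
    intro a b ha hab
    have := intervalIntegral.integral_mono_on hab
      (intervalIntegrable_const (c := 1 / h b)) (hint a b ha (ha.trans hab))
      (fun z hz => anti (ha.trans hz.1) (ha.trans hab) hz.2)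
    rw [intervalIntegral.integral_const, smul_eq_mul, mul_one_div] at this
    exact this
  have upper : ∀ a b, xmin ≤ a → a ≤ b → ∫ z in a..b, 1 / h z ≤ (b - a) / h a := by
    intro a b ha hab
    have := intervalIntegral.integral_mono_on hab (hint a b ha (ha.trans hab))
      (intervalIntegrable_const (c := 1 / h a))
      (fun z hz => anti ha (ha.trans hz.1) hz.1)
    rw [intervalIntegral.integral_const, smul_eq_mul, mul_one_div] at this
    exact this
  intro x hx y hy
  have hxp := hpos x hx
  rcases lt_or_ge y xmin with hlt | hge
  · rw [hg_below y hy hlt, hg_above x hx]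
    have h1 := lower xmin x le_rfl hx
    have h2 : xmin / h x ≤ xmin / h xmin :=
      div_le_div_of_nonneg_left hxmin.le (hpos xmin Set.self_mem_Ici) (hmono Set.self_mem_Ici hx hx)
    have h3 : (x - y) / h x ≤ x / h x := by gcongr; linarith
    rw [sub_div] at h1
    linarith
  · rw [hg_above x hx, hg_above y hge]
    have e := intervalIntegral.integral_add_adjacent_intervals
      (hint xmin y le_rfl hge) (hint y x hge hx)
    rcases le_total y x with hyx | hxy
    · have := lower y x hge hyx
      linarith
    · have := upper x y hx hxy
      rw [intervalIntegral.integral_symm] at this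
      have e2 : (x - y) / h x = -((y - x) / h x) := by ring
      linarith
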